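/- Let 0 < a < π√3/4, let Δ = Δ_hex(a) be the hexagonal lattice ℤ·(2a,0) + ℤ·(a, a√3), and let Λ = (2Δ) × 2πℤ ⊂ ℝ³ (the lattice generated by (4a,0,0), (2a, 2a√3, 0), and (0,0,2π)). Then the infimum of L_Δ(γ) over all nonzero v ∈ Λ, all m ∈ ℝ³ and all piecewise C¹ curves γ : [0,1] → ℝ³ with γ(0) = m and γ(1) = m + v equals min( 4a , 2π·cos(2a/√3) ). (This is the systole of the singular torus (T, g_hex) = (ℝ³, h)/Λ.) -/

import Mathlib

open Real MeasureTheory Set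

noncomputable section

/-- The point `(x, y)` of the Euclidean plane. -/
def pt2 (x y : ℝ) : EuclideanSpace ℝ (Fin 2) := (WithLp.equiv 2 (Fin 2 → ℝ)).symm ![x, y]

/-- `f : [0,1] → ℝ` is piecewise `C¹`. -/
def PC1 (f : ℝ → ℝ) : Prop :=
  ∃ (n : ℕ) (t : ℕ → ℝ), t 0 = 0 ∧ t n = 1 ∧ (∀ i < n, t i < t (i + 1)) ∧
    ContinuousOn f (Set.Icc 0 1) ∧ ∀ i < n, ContDiffOn ℝ 1 f (Set.Icc (t i) (t (i + 1)))

/-- Length of `γ = (γ₁,γ₂,γ₃)` for the singular metric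
`h = dx² + dy² + cos²(dist((x,y),Δ)) dz²`. -/
def sLen (Δ : Set (EuclideanSpace ℝ (Fin 2))) (γ₁ γ₂ γ₃ : ℝ → ℝ) : ℝ :=
  ∫ t in (0:ℝ)..1, Real.sqrt ((deriv γ₁ t) ^ 2 + (deriv γ₂ t) ^ 2 +
    Real.cos (Metric.infDist (pt2 (γ₁ t) (γ₂ t)) Δ) ^ 2 * (deriv γ₃ t) ^ 2)

/-- The hexagonal lattice `Δ_hex(a) = ℤ·(2a,0) + ℤ·(a, a√3) ⊂ ℝ²`. -/
def ΔhexE (a : ℝ) : Set (EuclideanSpace ℝ (Fin 2)) :=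
  {p | ∃ m n : ℤ, p = pt2 (2 * a * m + a * n) (a * Real.sqrt 3 * n)}

theorem ContDiffOn.intervalIntegrable_deriv {f : ℝ → ℝ} {a b : ℝ} (hab : a < b)
    (hf : ContDiffOn ℝ 1 f (Icc a b)) : IntervalIntegrable (deriv f) volume a b := by
  have hc : ContinuousOn (derivWithin f (Icc a b)) (uIcc a b) := by
    rw [uIcc_of_le hab.le]
    exact hf.continuousOn_derivWithin (uniqueDiffOn_Icc hab) le_rfl
  refine hc.intervalIntegrable.congr_uIoo fun x hx => ?_
  rw [uIoo_of_le hab.le] at hx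
  exact derivWithin_of_mem_nhds (Icc_mem_nhds hx.1 hx.2)

theorem ContDiffOn.intervalIntegral_deriv_eq_sub {f : ℝ → ℝ} {a b : ℝ} (hab : a < b)
    (hf : ContDiffOn ℝ 1 f (Icc a b)) : ∫ x in a..b, deriv f x = f b - f a :=
  intervalIntegral.integral_eq_sub_of_hasDerivAt_of_le hab.le hf.continuousOn
    (fun x hx => (((hf.differentiableOn one_ne_zero) x (Ioo_subset_Icc_self hx)).differentiableAt
      (Icc_mem_nhds hx.1 hx.2)).hasDerivAt) (hf.intervalIntegrable_deriv hab)

namespace PC1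

variable {f : ℝ → ℝ}

theorem continuousOn (hf : PC1 f) : ContinuousOn f (Icc 0 1) := by
  obtain ⟨_, _, _, _, _, hc, _⟩ := hf
  exact hc

theorem intervalIntegrable_deriv (hf : PC1 f) : IntervalIntegrable (deriv f) volume 0 1 := by
  obtain ⟨n, t, h0, h1, hlt, -, hC⟩ := hf
  rw [← h0, ← h1]
  exact IntervalIntegrable.trans_iterate fun i hi => (hC i hi).intervalIntegrable_deriv (hlt i hi)

theorem integral_deriv (hf : PC1 f) : ∫ x in (0:ℝ)..1, deriv f x = f 1 - f 0 := by
  obtain ⟨n, t, h0, h1, hlt, -, hC⟩ := hf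
  rw [← h0, ← h1, ← intervalIntegral.sum_integral_adjacent_intervals fun i hi =>
    (hC i hi).intervalIntegrable_deriv (hlt i hi), ← Finset.sum_range_sub (fun i => f (t i))]
  refine Finset.sum_congr rfl fun i hi => ?_
  rw [Finset.mem_range] at hi
  exact (hC i hi).intervalIntegral_deriv_eq_sub (hlt i hi)

theorem of_contDiff (hf : ContDiff ℝ 1 f) : PC1 f :=
  ⟨1, fun i => i, by simp, by simp, fun i _ => by simp, hf.continuous.continuousOn,
    fun _ _ => hf.contDiffOn⟩

end PC1

/-- The integrand of `sLen`. -/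
def sSpeed (Δ : Set (EuclideanSpace ℝ (Fin 2))) (γ₁ γ₂ γ₃ : ℝ → ℝ) (t : ℝ) : ℝ :=
  Real.sqrt ((deriv γ₁ t) ^ 2 + (deriv γ₂ t) ^ 2 +
    Real.cos (Metric.infDist (pt2 (γ₁ t) (γ₂ t)) Δ) ^ 2 * (deriv γ₃ t) ^ 2)

theorem continuous_pt2 : Continuous fun p : ℝ × ℝ => pt2 p.1 p.2 := by
  refine (PiLp.continuous_toLp 2 _).comp (continuous_pi fun i => ?_)
  fin_cases i
  · exact continuous_fst
  · exact continuous_snd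

theorem continuous_cos_infDist_pt2 (Δ : Set (EuclideanSpace ℝ (Fin 2))) :
    Continuous fun p : ℝ × ℝ => Real.cos (Metric.infDist (pt2 p.1 p.2) Δ) :=
  Real.continuous_cos.comp ((Metric.continuous_infDist_pt Δ).comp continuous_pt2)

section Length

variable {Δ : Set (EuclideanSpace ℝ (Fin 2))} {γ₁ γ₂ γ₃ : ℝ → ℝ}

theorem sSpeed_le (t : ℝ) :
    sSpeed Δ γ₁ γ₂ γ₃ t ≤ |deriv γ₁ t| + |deriv γ₂ t| + |deriv γ₃ t| := by
  have hc := Real.cos_sq_le_one (Metric.infDist (pt2 (γ₁ t) (γ₂ t)) Δ)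
  refine Real.sqrt_le_iff.2 ⟨by positivity, ?_⟩
  have h := mul_le_mul_of_nonneg_right hc (sq_nonneg (deriv γ₃ t))
  rw [← sq_abs (deriv γ₁ t), ← sq_abs (deriv γ₂ t)]
  rw [← sq_abs (deriv γ₃ t)] at h ⊢
  nlinarith [abs_nonneg (deriv γ₁ t), abs_nonneg (deriv γ₂ t), abs_nonneg (deriv γ₃ t),
    mul_nonneg (abs_nonneg (deriv γ₁ t)) (abs_nonneg (deriv γ₂ t)),
    mul_nonneg (abs_nonneg (deriv γ₁ t)) (abs_nonneg (deriv γ₃ t)),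
    mul_nonneg (abs_nonneg (deriv γ₂ t)) (abs_nonneg (deriv γ₃ t))]

theorem intervalIntegrable_sSpeed (h₁ : PC1 γ₁) (h₂ : PC1 γ₂) (h₃ : PC1 γ₃) :
    IntervalIntegrable (sSpeed Δ γ₁ γ₂ γ₃) volume 0 1 := by
  refine ((h₁.intervalIntegrable_deriv.abs.add h₂.intervalIntegrable_deriv.abs).add
    h₃.intervalIntegrable_deriv.abs).mono_fun ?_ (ae_of_all _ fun t => ?_)
  · rw [uIoc_of_le zero_le_one]
    have hcos : AEMeasurable
        (fun t => Real.cos (Metric.infDist (pt2 (γ₁ t) (γ₂ t)) Δ))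
        (volume.restrict (Ioc (0:ℝ) 1)) := by
      have hc := Continuous.comp_continuousOn' (continuous_cos_infDist_pt2 Δ)
        (h₁.continuousOn.prodMk h₂.continuousOn)
      exact (hc.mono Ioc_subset_Icc_self).aemeasurable measurableSet_Ioc
    have hplane : AEMeasurable (fun t => (deriv γ₁ t) ^ 2 + (deriv γ₂ t) ^ 2)
        (volume.restrict (Ioc (0:ℝ) 1)) :=
      (((measurable_deriv γ₁).pow_const 2).add ((measurable_deriv γ₂).pow_const 2)).aemeasurable
    have hvert : AEMeasurable (fun t => (deriv γ₃ t) ^ 2) (volume.restrict (Ioc (0:ℝ) 1)) :=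
      ((measurable_deriv γ₃).pow_const 2).aemeasurable
    exact (hplane.add ((hcos.pow_const 2).mul hvert)).sqrt.aestronglyMeasurable
  · exact (Real.norm_of_nonneg (Real.sqrt_nonneg _)).trans_le
      ((sSpeed_le t).trans (le_abs_self _))

/-- The length is at least the Euclidean norm of the planar displacement. -/
theorem sqrt_le_sLen (h₁ : PC1 γ₁) (h₂ : PC1 γ₂) (h₃ : PC1 γ₃) :
    √((γ₁ 1 - γ₁ 0) ^ 2 + (γ₂ 1 - γ₂ 0) ^ 2) ≤ sLen Δ γ₁ γ₂ γ₃ := by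
  set X := γ₁ 1 - γ₁ 0 with hX
  set Y := γ₂ 1 - γ₂ 0 with hY
  set R := √(X ^ 2 + Y ^ 2) with hR
  have hRR : R ^ 2 = X ^ 2 + Y ^ 2 := Real.sq_sqrt (by positivity)
  have i₁ := h₁.intervalIntegrable_deriv.const_mul X
  have i₂ := h₂.intervalIntegrable_deriv.const_mul Y
  have hmono : ∫ t in (0:ℝ)..1, (X * deriv γ₁ t + Y * deriv γ₂ t) ≤
      ∫ t in (0:ℝ)..1, R * sSpeed Δ γ₁ γ₂ γ₃ t := by
    refine intervalIntegral.integral_mono_on zero_le_one (i₁.add i₂)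
      ((intervalIntegrable_sSpeed h₁ h₂ h₃).const_mul R) fun t _ => ?_
    rw [hR, sSpeed, ← Real.sqrt_mul (by positivity)]
    refine Real.le_sqrt_of_sq_le ?_
    have hnn : 0 ≤ (X ^ 2 + Y ^ 2) *
        (Real.cos (Metric.infDist (pt2 (γ₁ t) (γ₂ t)) Δ) ^ 2 * (deriv γ₃ t) ^ 2) := by positivity
    nlinarith [sq_nonneg (X * deriv γ₂ t - Y * deriv γ₁ t)]
  rw [intervalIntegral.integral_add i₁ i₂, intervalIntegral.integral_const_mul,
    intervalIntegral.integral_const_mul, intervalIntegral.integral_const_mul,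
    h₁.integral_deriv, h₂.integral_deriv, ← hX, ← hY] at hmono
  change _ ≤ R * sLen Δ γ₁ γ₂ γ₃ at hmono
  rcases (Real.sqrt_nonneg (X ^ 2 + Y ^ 2)).eq_or_lt with h0 | hpos
  · rw [hR, ← h0]
    exact intervalIntegral.integral_nonneg zero_le_one fun t _ => Real.sqrt_nonneg _
  · exact le_of_mul_le_mul_left (by nlinarith) hpos

/-- The length is at least the vertical displacement times a lower bound of the warping factor. -/
theorem mul_abs_le_sLen {c : ℝ} (hc0 : 0 ≤ c)
    (hc : ∀ x y, c ≤ Real.cos (Metric.infDist (pt2 x y) Δ))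
    (h₁ : PC1 γ₁) (h₂ : PC1 γ₂) (h₃ : PC1 γ₃) :
    c * |γ₃ 1 - γ₃ 0| ≤ sLen Δ γ₁ γ₂ γ₃ := by
  have hmono : ∫ t in (0:ℝ)..1, c * |deriv γ₃ t| ≤ ∫ t in (0:ℝ)..1, sSpeed Δ γ₁ γ₂ γ₃ t := by
    refine intervalIntegral.integral_mono_on zero_le_one
      (h₃.intervalIntegrable_deriv.abs.const_mul c)
      (intervalIntegrable_sSpeed h₁ h₂ h₃) fun t _ => Real.le_sqrt_of_sq_le ?_
    have h := mul_le_mul_of_nonneg_right (pow_le_pow_left₀ hc0 (hc (γ₁ t) (γ₂ t)) 2)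
      (sq_nonneg (deriv γ₃ t))
    rw [mul_pow, sq_abs]
    nlinarith [sq_nonneg (deriv γ₁ t), sq_nonneg (deriv γ₂ t)]
  rw [intervalIntegral.integral_const_mul] at hmono
  rw [← h₃.integral_deriv]
  exact (mul_le_mul_of_nonneg_left
    (intervalIntegral.abs_integral_le_integral_abs zero_le_one) hc0).trans hmono

end Length

theorem dist_pt2 (x y x' y' : ℝ) :
    dist (pt2 x y) (pt2 x' y') = √((x - x') ^ 2 + (y - y') ^ 2) := by
  simp [pt2, EuclideanSpace.dist_eq, Fin.sum_univ_two, Real.dist_eq, sq_abs]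

theorem pt2_mem_ΔhexE (a : ℝ) (m n : ℤ) : pt2 (2 * a * m + a * n) (a * √3 * n) ∈ ΔhexE a :=
  ⟨m, n, rfl⟩

theorem exists_int_hexForm_sub_le (s t : ℝ) :
    ∃ m n : ℤ, (s - m) ^ 2 + (s - m) * (t - n) + (t - n) ^ 2 ≤ 1 / 3 := by
  have key : ∀ σ τ : ℝ, 0 ≤ σ → 0 ≤ τ → σ + τ ≤ 1 →
      σ ^ 2 + σ * τ + τ ^ 2 ≤ 1 / 3 ∨ (σ - 1) ^ 2 + (σ - 1) * τ + τ ^ 2 ≤ 1 / 3 ∨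
        σ ^ 2 + σ * (τ - 1) + (τ - 1) ^ 2 ≤ 1 / 3 := by
    intro σ τ hσ hτ h
    by_contra! hcon
    obtain ⟨c₁, c₂, c₃⟩ := hcon
    have d₁ := mul_le_mul_of_nonneg_left c₁.le (sub_nonneg.2 h)
    have d₂ := mul_le_mul_of_nonneg_left c₂.le hσ
    have d₃ := mul_le_mul_of_nonneg_left c₃.le hτ
    have hsq : (σ - 1 / 3) ^ 2 + (σ - 1 / 3) * (τ - 1 / 3) + (τ - 1 / 3) ^ 2 ≤ 0 := by
      nlinarith
    have hσ' : σ = 1 / 3 := by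
      nlinarith [sq_nonneg (σ - 1 / 3 + 2 * (τ - 1 / 3)), sq_nonneg (σ - 1 / 3)]
    have hτ' : τ = 1 / 3 := by
      subst hσ'
      nlinarith [sq_nonneg (τ - 1 / 3)]
    subst hσ' hτ'
    norm_num at c₁
  rcases le_total (Int.fract s + Int.fract t) 1 with h | h
  · rcases key _ _ (Int.fract_nonneg s) (Int.fract_nonneg t) h with h | h | h
    · exact ⟨⌊s⌋, ⌊t⌋, h⟩
    · exact ⟨⌊s⌋ + 1, ⌊t⌋, by rw [Int.fract, Int.fract] at h; push_cast; linarith⟩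
    · exact ⟨⌊s⌋, ⌊t⌋ + 1, by rw [Int.fract, Int.fract] at h; push_cast; linarith⟩
  · rcases key (1 - Int.fract s) (1 - Int.fract t) (by linarith [Int.fract_lt_one s])
      (by linarith [Int.fract_lt_one t]) (by linarith) with h | h | h
    · exact ⟨⌊s⌋ + 1, ⌊t⌋ + 1, by rw [Int.fract, Int.fract] at h; push_cast; linarith⟩
    · exact ⟨⌊s⌋, ⌊t⌋ + 1, by rw [Int.fract, Int.fract] at h; push_cast; linarith⟩
    · exact ⟨⌊s⌋ + 1, ⌊t⌋, by rw [Int.fract, Int.fract] at h; push_cast; linarith⟩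

/-- The covering radius of the hexagonal lattice is at most `2a/√3`. -/
theorem infDist_ΔhexE_le {a : ℝ} (ha : 0 < a) (x y : ℝ) :
    Metric.infDist (pt2 x y) (ΔhexE a) ≤ 2 * a / √3 := by
  have h3 : √3 ^ 2 = 3 := Real.sq_sqrt (by norm_num)
  have h3' : √3 ≠ 0 := by positivity
  set t := y / (a * √3) with ht
  set s := (x - a * t) / (2 * a) with hs
  have hy : y = a * √3 * t := by rw [ht]; field_simp
  have hx : x = 2 * a * s + a * t := by rw [hs]; field_simp; ring
  obtain ⟨m, n, hmn⟩ := exists_int_hexForm_sub_le s t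
  refine (Metric.infDist_le_dist_of_mem (pt2_mem_ΔhexE a m n)).trans ?_
  rw [dist_pt2]
  refine Real.sqrt_le_iff.2 ⟨by positivity, ?_⟩
  rw [div_pow, h3, hx, hy]
  have e : (2 * a * s + a * t - (2 * a * m + a * n)) ^ 2 + (a * √3 * t - a * √3 * n) ^ 2 =
      4 * a ^ 2 * ((s - m) ^ 2 + (s - m) * (t - n) + (t - n) ^ 2) := by
    linear_combination a ^ 2 * (t - n) ^ 2 * h3
  rw [e]
  nlinarith [mul_le_mul_of_nonneg_left hmn (by positivity : 0 ≤ 4 * a ^ 2)]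

/-- The circumcentre of a fundamental triangle realises the covering radius. -/
theorem infDist_circumcentre_ΔhexE {a : ℝ} (ha : 0 < a) :
    Metric.infDist (pt2 a (a / √3)) (ΔhexE a) = 2 * a / √3 := by
  have h3 : √3 ^ 2 = 3 := Real.sq_sqrt (by norm_num)
  refine le_antisymm (infDist_ΔhexE_le ha _ _) ?_
  refine (Metric.le_infDist ⟨_, pt2_mem_ΔhexE a 0 0⟩).2 ?_
  rintro _ ⟨m, n, rfl⟩
  rw [dist_pt2]
  refine Real.le_sqrt_of_sq_le ?_
  have hint : 4 ≤ 3 * (1 - 2 * m - n) ^ 2 + (1 - 3 * n) ^ 2 := by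
    rcases eq_or_ne n 0 with rfl | hn
    · have : 1 - 2 * m ≠ 0 := by omega
      have := Int.one_le_abs this
      rw [← sq_abs (1 - 2 * m - 0)]
      simp only [sub_zero]
      nlinarith
    · have : 2 ≤ |1 - 3 * n| := le_abs.2 (by omega)
      rw [← sq_abs (1 - 3 * n)]
      nlinarith [sq_nonneg (1 - 2 * m - n)]
  have hreal : (4 : ℝ) ≤ 3 * (1 - 2 * m - n) ^ 2 + (1 - 3 * n) ^ 2 := by exact_mod_cast hint
  have hq : a / √3 = a * √3 / 3 := by
    field_simp
    linarith
  rw [div_pow, h3, hq]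
  have e : (a - (2 * a * m + a * n)) ^ 2 + (a * √3 / 3 - a * √3 * n) ^ 2 =
      a ^ 2 / 3 * (3 * (1 - 2 * m - n) ^ 2 + (1 - 3 * n) ^ 2) := by
    linear_combination a ^ 2 * (1 / 3 - n) ^ 2 * h3
  rw [e]
  nlinarith [mul_le_mul_of_nonneg_left hreal (by positivity : 0 ≤ a ^ 2 / 3)]

theorem one_le_hexForm {k l : ℤ} (h : ¬(k = 0 ∧ l = 0)) : 1 ≤ k ^ 2 + k * l + l ^ 2 := by
  by_contra! hlt
  have hk : k ^ 2 ≤ 0 := by nlinarith [sq_nonneg (k + 2 * l)]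
  have hl : l ^ 2 ≤ 0 := by nlinarith [sq_nonneg (2 * k + l)]
  exact h ⟨pow_eq_zero_iff two_ne_zero |>.1 (le_antisymm hk (sq_nonneg k)),
    pow_eq_zero_iff two_ne_zero |>.1 (le_antisymm hl (sq_nonneg l))⟩

/-- for `0 < a < π√3/4`, `Δ = Δ_hex(a)` and `Λ = (2Δ) × 2πℤ` (generated by
`(4a,0,0)`, `(2a, 2a√3, 0)`, `(0,0,2π)`), the infimum of `L_Δ(γ)` over all nonzero `v ∈ Λ`,
all `m ∈ ℝ³` and all piecewise `C¹` curves `γ` from `m` to `m + v` equals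
`min(4a, 2π cos(2a/√3))`: the systole of the singular torus `(T, g_hex)`. -/
theorem systole_singular_hexagonal_torus (a : ℝ) (ha : 0 < a)
    (ha' : a < π * Real.sqrt 3 / 4) :
    sInf {L : ℝ | ∃ (k₁ k₂ k₃ : ℤ) (γ₁ γ₂ γ₃ : ℝ → ℝ),
        ¬(k₁ = 0 ∧ k₂ = 0 ∧ k₃ = 0) ∧ PC1 γ₁ ∧ PC1 γ₂ ∧ PC1 γ₃ ∧
        γ₁ 1 = γ₁ 0 + (4 * a * k₁ + 2 * a * k₂) ∧ γ₂ 1 = γ₂ 0 + 2 * a * Real.sqrt 3 * k₂ ∧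
        γ₃ 1 = γ₃ 0 + 2 * π * k₃ ∧
        L = sLen (ΔhexE a) γ₁ γ₂ γ₃} =
      min (4 * a) (2 * π * Real.cos (2 * a / Real.sqrt 3)) := by
  have hs3 : √3 ^ 2 = 3 := Real.sq_sqrt (by norm_num)
  have hs3' : 0 < √3 := by positivity
  have hρ : 2 * a / √3 < π / 2 := by
    rw [div_lt_iff₀ hs3']
    linarith
  have hρ0 : 0 ≤ 2 * a / √3 := by positivity
  have hcos : 0 < Real.cos (2 * a / √3) :=
    Real.cos_pos_of_mem_Ioo ⟨by linarith [Real.pi_pos], hρ⟩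
  refine IsLeast.csInf_eq ⟨?_, ?_⟩
  · rcases min_choice (4 * a) (2 * π * Real.cos (2 * a / √3)) with h | h <;> rw [h]
    · refine ⟨1, 0, 0, fun t => 4 * a * t, fun _ => 0, fun _ => 0, by simp,
        .of_contDiff (by fun_prop), .of_contDiff (by fun_prop), .of_contDiff (by fun_prop),
        by simp, by simp, by simp, ?_⟩
      have hd : ∀ t, deriv (fun t : ℝ => 4 * a * t) t = 4 * a := fun t => by simp
      have hnn : 0 ≤ 4 * a := by positivity
      simp [sLen, hd, -deriv_const_mul_field', Real.sqrt_sq hnn]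
    · refine ⟨0, 0, 1, fun _ => a, fun _ => a / √3, fun t => 2 * π * t, by simp,
        .of_contDiff (by fun_prop), .of_contDiff (by fun_prop), .of_contDiff (by fun_prop),
        by simp, by simp, by simp, ?_⟩
      have hd : ∀ t, deriv (fun t : ℝ => 2 * π * t) t = 2 * π := fun t => by simp
      have hnn : 0 ≤ Real.cos (2 * a / √3) * (2 * π) := by positivity
      simp only [sLen, infDist_circumcentre_ΔhexE ha, hd, deriv_const, ← mul_pow]
      simp only [ne_eq, OfNat.ofNat_ne_zero, not_false_eq_true, zero_pow, add_zero, zero_add,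
        Real.sqrt_sq hnn, intervalIntegral.integral_const, sub_zero, one_smul]
      ring
  · rintro _ ⟨k₁, k₂, k₃, γ₁, γ₂, γ₃, hk, h₁, h₂, h₃, e₁, e₂, e₃, rfl⟩
    by_cases hk12 : k₁ = 0 ∧ k₂ = 0
    · refine (min_le_right _ _).trans ?_
      have hk3 : k₃ ≠ 0 := fun h => hk ⟨hk12.1, hk12.2, h⟩
      have hk3' : (1 : ℝ) ≤ |(k₃ : ℝ)| := by exact_mod_cast Int.one_le_abs hk3
      have hle := mul_abs_le_sLen (Δ := ΔhexE a) hcos.le (fun x y =>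
        Real.cos_le_cos_of_nonneg_of_le_pi Metric.infDist_nonneg (by linarith)
          (infDist_ΔhexE_le ha x y)) h₁ h₂ h₃
      refine le_trans ?_ hle
      rw [e₃, add_sub_cancel_left, abs_mul, abs_of_pos Real.two_pi_pos]
      nlinarith [mul_le_mul_of_nonneg_left hk3' (mul_pos hcos Real.two_pi_pos).le]
    · refine (min_le_left _ _).trans (le_trans ?_ (sqrt_le_sLen h₁ h₂ h₃))
      refine Real.le_sqrt_of_sq_le ?_
      have hq : (1 : ℝ) ≤ (k₁ : ℝ) ^ 2 + k₁ * k₂ + (k₂ : ℝ) ^ 2 := by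
        exact_mod_cast one_le_hexForm hk12
      rw [e₁, e₂, add_sub_cancel_left, add_sub_cancel_left]
      have e : (4 * a * k₁ + 2 * a * k₂) ^ 2 + (2 * a * √3 * k₂) ^ 2 =
          16 * a ^ 2 * ((k₁ : ℝ) ^ 2 + k₁ * k₂ + (k₂ : ℝ) ^ 2) := by
        linear_combination 4 * a ^ 2 * (k₂ : ℝ) ^ 2 * hs3
      rw [e]
      nlinarith [mul_le_mul_of_nonneg_left hq (by positivity : 0 ≤ 16 * a ^ 2)]

end
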